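/- Core q-difference lemma for an upper parameter with real index: let q ∈ ℝ with 0 < q < 1, let a ∈ ℝ with a ≠ 0 and a ≠ 1, and let x ∈ ℝ. Assume the infinite products (a q^x; q)_∞ and (a q^{x+1}; q)_∞ are nonzero. Then, with the real-index q-Pochhammer (a;q)_x = (a;q)_∞ / (a q^x; q)_∞, one has ((aq;q)_x − (a;q)_x) / ((q−1) a) = −(1/(1−a)) · ((q^x − 1)/(q − 1)) · (a;q)_x = −([x]_q/(1−a)) (a;q)_x. -/

import Mathlib

/-- The infinite q-Pochhammer symbol `(a;q)_∞ = ∏_{m=0}^∞ (1 − a q^m)`. -/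
noncomputable def qPochInf (q a : ℝ) : ℝ := ∏' m : ℕ, (1 - a * q ^ m)

/-- The real-index q-Pochhammer symbol `(a;q)_x = (a;q)_∞ / (a q^x; q)_∞`. -/
noncomputable def qPochR (q a x : ℝ) : ℝ := qPochInf q a / qPochInf q (a * q ^ x)

/-- The q-bracket `[x]_q = (1 − q^x)/(1 − q)` for real `x`. -/
noncomputable def qBracket (q x : ℝ) : ℝ := (1 - q ^ x) / (1 - q)

lemma qPochInf_step (q a : ℝ) (hq0 : 0 < q) (hq1 : q < 1) :
    qPochInf q a = (1 - a) * qPochInf q (a * q) := by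
  unfold qPochInf
  have hm : Multipliable (fun m : ℕ => 1 - a * q ^ (m + 1)) := by
    have hs : Summable (fun m : ℕ => ‖-(a * q ^ (m + 1))‖) := by
      have h := ((summable_geometric_of_lt_one hq0.le hq1).mul_left (a * q)).norm
      refine h.congr (fun m => ?_)
      rw [norm_neg, pow_succ]
      congr 1
      ring
    simpa [sub_eq_add_neg] using multipliable_one_add_of_summable hs
  rw [tprod_eq_zero_mul' (f := fun m : ℕ => 1 - a * q ^ m) hm]
  simp only [pow_zero, mul_one]
  congr 1
  refine tprod_congr (fun m => ?_)
  ring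

/-- Core q-difference lemma for an upper parameter with real index:
`((aq;q)_x − (a;q)_x) / ((q−1) a) = −(1/(1−a)) ((q^x − 1)/(q − 1)) (a;q)_x
  = −([x]_q/(1−a)) (a;q)_x`. -/
theorem stmt_3 (q a x : ℝ) (hq0 : 0 < q) (hq1 : q < 1) (ha0 : a ≠ 0) (ha1 : a ≠ 1)
    (h1 : qPochInf q (a * q ^ x) ≠ 0) (h2 : qPochInf q (a * q ^ (x + 1)) ≠ 0) :
    ((qPochR q (a * q) x - qPochR q a x) / ((q - 1) * a) =
      -(1 / (1 - a)) * ((q ^ x - 1) / (q - 1)) * qPochR q a x) ∧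
    ((qPochR q (a * q) x - qPochR q a x) / ((q - 1) * a) =
      -(qBracket q x / (1 - a)) * qPochR q a x) := by
  have e1 := qPochInf_step q a hq0 hq1
  have e2 := qPochInf_step q (a * q ^ x) hq0 hq1
  have e3 : a * q ^ (x + 1) = a * q ^ x * q := by
    rw [Real.rpow_add hq0, Real.rpow_one]; ring
  have e4 : a * q * q ^ x = a * q ^ x * q := by ring
  rw [e3] at h2
  have key : (qPochR q (a * q) x - qPochR q a x) / ((q - 1) * a) =
      -(1 / (1 - a)) * ((q ^ x - 1) / (q - 1)) * qPochR q a x := by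
    unfold qPochR
    rw [e4, e1, e2]
    rw [e2] at h1
    have h3 : 1 - a * q ^ x ≠ 0 := left_ne_zero_of_mul h1
    have h4 : 1 - a ≠ 0 := sub_ne_zero.mpr ha1.symm
    have h5 : q - 1 ≠ 0 := by linarith
    generalize qPochInf q (a * q ^ x * q) = B at *
    generalize qPochInf q (a * q) = A at *
    generalize q ^ x = Q at *
    field_simp
    ring
  refine ⟨key, key.trans ?_⟩
  unfold qBracket
  rw [← neg_div_neg_eq (q ^ x - 1) (q - 1), neg_sub, neg_sub]
  ring
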